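/- Let C_G(E) denote the capacity of the average-intensity-constrained Gaussian optical intensity channel. Then liminf_{E → 0⁺} C_G(E) / (E · √(log(1/E))) ≥ 1/√2. -/

import Mathlib

open MeasureTheory ProbabilityTheory Filter
open scoped Classical

/-- Kullback–Leibler divergence (natural logarithm), with value `⊤` when it is
not defined as a real number. -/
noncomputable def klDiv {α : Type*} [MeasurableSpace α] (μ ν : Measure α) : EReal :=
  if μ ≪ ν ∧ Integrable (fun x => Real.log (μ.rnDeriv ν x).toReal) μ
  then ((∫ x, Real.log (μ.rnDeriv ν x).toReal ∂μ : ℝ) : EReal)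
  else ⊤

/-- Mutual information between the input `X ~ μ` and the output `Y = X + Z` of the
Gaussian optical intensity channel, where `Z ~ N(0,1)` is independent of `X`:
the KL divergence between the joint law of `(X, X + Z)` and the product of its
two marginals. -/
noncomputable def gaussianMI (μ : Measure ℝ) : EReal :=
  let joint : Measure (ℝ × ℝ) :=
    (μ.prod (gaussianReal 0 1)).map (fun p => (p.1, p.1 + p.2))
  klDiv joint (joint.fst.prod joint.snd)

/-- Capacity of the average-intensity-constrained Gaussian optical intensity channel:
the supremum of the mutual information over all probability measures on `ℝ`
concentrated on `[0, ∞)` with mean at most `E`. -/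
noncomputable def C_G (E : ℝ) : EReal :=
  ⨆ (μ : Measure ℝ) (_ : IsProbabilityMeasure μ) (_ : μ (Set.Iio 0) = 0)
    (_ : ∫⁻ x, ENNReal.ofReal x ∂μ ≤ ENNReal.ofReal E), gaussianMI μ


/-- Density of the channel output `X + Z` for the input law `μ`. -/
noncomputable def outputDensity (μ : Measure ℝ) (y : ℝ) : ENNReal :=
  ∫⁻ x, gaussianPDF x 1 y ∂μ

/-- The channel input and output as a function of the input and the noise. -/
def inputOutput (p : ℝ × ℝ) : ℝ × ℝ := (p.1, p.1 + p.2)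

/-- Information density of the channel, as a function of the input and the noise. -/
noncomputable def informationDensity (μ : Measure ℝ) (p : ℝ × ℝ) : ℝ :=
  Real.log (gaussianPDFReal 0 1 p.2 / (outputDensity μ (p.1 + p.2)).toReal)

lemma measurable_inputOutput : Measurable inputOutput := by
  unfold inputOutput; fun_prop

lemma gaussianPDFReal_one (x y : ℝ) :
    gaussianPDFReal x 1 y = (√(2 * Real.pi))⁻¹ * Real.exp (-(y - x) ^ 2 / 2) := by
  simp [gaussianPDFReal]

lemma gaussianPDFReal_one_add (x z : ℝ) :
    gaussianPDFReal x 1 (x + z) = gaussianPDFReal 0 1 z := by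
  simp [gaussianPDFReal_one]

lemma gaussianPDFReal_one_le (x y : ℝ) : gaussianPDFReal x 1 y ≤ (√(2 * Real.pi))⁻¹ := by
  rw [gaussianPDFReal_one]
  refine mul_le_of_le_one_right (by positivity) (Real.exp_le_one_iff.2 ?_)
  nlinarith [sq_nonneg (y - x)]

lemma measurable_gaussianPDF_uncurry :
    Measurable (fun p : ℝ × ℝ => gaussianPDF p.1 1 p.2) := by
  simp only [gaussianPDF, gaussianPDFReal_one]
  fun_prop

lemma measurable_outputDensity (μ : Measure ℝ) [SFinite μ] : Measurable (outputDensity μ) := by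
  have h : Measurable (Function.uncurry fun x y => gaussianPDF x 1 y) :=
    measurable_gaussianPDF_uncurry
  exact h.lintegral_prod_left

lemma outputDensity_ne_zero (μ : Measure ℝ) [NeZero μ] (y : ℝ) : outputDensity μ y ≠ 0 := by
  unfold outputDensity
  have hm : Measurable (fun x => gaussianPDF x 1 y) := by
    simp only [gaussianPDF, gaussianPDFReal_one]
    fun_prop
  rw [Ne, lintegral_eq_zero_iff hm]
  intro h
  refine NeZero.ne μ (ae_eq_bot.1 (Filter.eventually_false_iff_eq_bot.1 ?_))
  filter_upwards [h] with x hx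
  exact (gaussianPDF_pos x one_ne_zero y).ne' hx

lemma outputDensity_le (μ : Measure ℝ) [IsProbabilityMeasure μ] (y : ℝ) :
    outputDensity μ y ≤ ENNReal.ofReal (√(2 * Real.pi))⁻¹ := by
  calc outputDensity μ y ≤ ∫⁻ _, ENNReal.ofReal (√(2 * Real.pi))⁻¹ ∂μ :=
        lintegral_mono fun x => ENNReal.ofReal_le_ofReal (gaussianPDFReal_one_le x y)
    _ = _ := by simp

lemma outputDensity_ne_top (μ : Measure ℝ) [IsProbabilityMeasure μ] (y : ℝ) :
    outputDensity μ y ≠ ⊤ :=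
  ((outputDensity_le μ y).trans_lt ENNReal.ofReal_lt_top).ne

lemma outputDensity_toReal_pos (μ : Measure ℝ) [IsProbabilityMeasure μ] (y : ℝ) :
    0 < (outputDensity μ y).toReal :=
  ENNReal.toReal_pos (outputDensity_ne_zero μ y) (outputDensity_ne_top μ y)

lemma outputDensity_toReal_le (μ : Measure ℝ) [IsProbabilityMeasure μ] (y : ℝ) :
    (outputDensity μ y).toReal ≤ (√(2 * Real.pi))⁻¹ :=
  ENNReal.toReal_le_of_le_ofReal (by positivity) (outputDensity_le μ y)

lemma measurable_informationDensity (μ : Measure ℝ) [SFinite μ] :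
    Measurable (informationDensity μ) := by
  have := measurable_outputDensity μ
  have := measurable_gaussianPDFReal 0 1
  unfold informationDensity
  fun_prop

lemma lintegral_noise (x : ℝ) {f : ℝ → ENNReal} (hf : Measurable f) :
    ∫⁻ z, f (x + z) ∂(gaussianReal 0 1) = ∫⁻ y, gaussianPDF x 1 y * f y := by
  rw [← lintegral_map hf (by fun_prop), gaussianReal_map_const_add, zero_add,
    gaussianReal_of_var_ne_zero _ one_ne_zero,
    lintegral_withDensity_eq_lintegral_mul _ (measurable_gaussianPDF x 1) hf]
  rfl

lemma map_inputOutput (μ : Measure ℝ) [IsProbabilityMeasure μ] :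
    (μ.prod (gaussianReal 0 1)).map inputOutput =
      (μ.prod volume).withDensity (fun p => gaussianPDF p.1 1 p.2) := by
  refine Measure.ext_of_lintegral _ fun f hf => ?_
  have hw := measurable_gaussianPDF_uncurry
  rw [lintegral_map hf measurable_inputOutput,
    lintegral_prod (fun p => f (inputOutput p)) (hf.comp measurable_inputOutput).aemeasurable,
    lintegral_withDensity_eq_lintegral_mul _ hw hf, lintegral_prod _ (hw.mul hf).aemeasurable]
  refine lintegral_congr fun x => ?_
  exact lintegral_noise x (hf.comp measurable_prodMk_left)

lemma fst_map_inputOutput (μ : Measure ℝ) :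
    ((μ.prod (gaussianReal 0 1)).map inputOutput).fst = μ := by
  change ((μ.prod (gaussianReal 0 1)).map (fun p => (p.1, p.1 + p.2))).fst = μ
  rw [Measure.fst_map_prodMk (by fun_prop)]
  exact Measure.fst_prod

lemma snd_map_inputOutput (μ : Measure ℝ) [IsProbabilityMeasure μ] :
    ((μ.prod (gaussianReal 0 1)).map inputOutput).snd =
      volume.withDensity (outputDensity μ) := by
  refine Measure.ext_of_lintegral _ fun f hf => ?_
  have hw := measurable_gaussianPDF_uncurry
  have hf2 : Measurable fun p : ℝ × ℝ => f p.2 := hf.comp measurable_snd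
  rw [map_inputOutput, Measure.snd, lintegral_map hf measurable_snd,
    lintegral_withDensity_eq_lintegral_mul _ hw hf2,
    lintegral_prod_symm _ (hw.mul hf2).aemeasurable,
    lintegral_withDensity_eq_lintegral_mul _ (measurable_outputDensity μ) hf]
  refine lintegral_congr fun y => ?_
  exact lintegral_mul_const (f y) (hw.comp (measurable_id.prodMk measurable_const))

lemma map_inputOutput_eq_withDensity (μ : Measure ℝ) [IsProbabilityMeasure μ] :
    (μ.prod (gaussianReal 0 1)).map inputOutput =
      (μ.prod (volume.withDensity (outputDensity μ))).withDensity
        (fun p => gaussianPDF p.1 1 p.2 / outputDensity μ p.2) := by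
  have hq := measurable_outputDensity μ
  have hw := measurable_gaussianPDF_uncurry
  have hq2 : Measurable fun p : ℝ × ℝ => outputDensity μ p.2 := hq.comp measurable_snd
  have hd : Measurable fun p : ℝ × ℝ => gaussianPDF p.1 1 p.2 / outputDensity μ p.2 :=
    hw.div hq2
  rw [prod_withDensity_right hq, ← withDensity_mul _ hq2 hd, map_inputOutput]
  congr 1
  ext p
  exact (ENNReal.mul_div_cancel (outputDensity_ne_zero μ _) (outputDensity_ne_top μ _)).symm

lemma gaussianMI_eq_integral (μ : Measure ℝ) [IsProbabilityMeasure μ]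
    (h : Integrable (informationDensity μ) (μ.prod (gaussianReal 0 1))) :
    gaussianMI μ = ((∫ p, informationDensity μ p ∂(μ.prod (gaussianReal 0 1)) : ℝ) : EReal) := by
  set J := (μ.prod (gaussianReal 0 1)).map inputOutput with hJ
  set P := μ.prod (volume.withDensity (outputDensity μ)) with hP
  have hq := measurable_outputDensity μ
  have hw := measurable_gaussianPDF_uncurry
  have hq2 : Measurable fun p : ℝ × ℝ => outputDensity μ p.2 := hq.comp measurable_snd
  have : IsProbabilityMeasure J := Measure.isProbabilityMeasure_map
    measurable_inputOutput.aemeasurable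
  have : IsProbabilityMeasure (volume.withDensity (outputDensity μ)) := by
    rw [← snd_map_inputOutput]; infer_instance
  have hJP : J = P.withDensity (fun p => gaussianPDF p.1 1 p.2 / outputDensity μ p.2) :=
    map_inputOutput_eq_withDensity μ
  have hac : J ≪ P := hJP ▸ withDensity_absolutelyContinuous _ _
  have hrn : (fun p => Real.log (J.rnDeriv P p).toReal) =ᵐ[J]
      fun p => Real.log (gaussianPDFReal p.1 1 p.2 / (outputDensity μ p.2).toReal) := by
    have h1 : J.rnDeriv P =ᵐ[P] fun p => gaussianPDF p.1 1 p.2 / outputDensity μ p.2 := by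
      rw [hJP]; exact Measure.rnDeriv_withDensity _ (hw.div hq2)
    filter_upwards [hac.ae_le h1] with p hp
    rw [hp, ENNReal.toReal_div, toReal_gaussianPDF]
  have hlog : Measurable fun p : ℝ × ℝ =>
      Real.log (gaussianPDFReal p.1 1 p.2 / (outputDensity μ p.2).toReal) := by
    simp only [gaussianPDFReal_one]
    fun_prop
  have hcomp : (fun p : ℝ × ℝ => Real.log (gaussianPDFReal p.1 1 p.2 /
      (outputDensity μ p.2).toReal)) ∘ inputOutput = informationDensity μ := by
    ext p
    simp only [Function.comp, inputOutput, informationDensity, gaussianPDFReal_one_add]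
  have hint : Integrable (fun p => Real.log (J.rnDeriv P p).toReal) J := by
    rw [integrable_congr hrn, hJ, integrable_map_measure hlog.aestronglyMeasurable
      measurable_inputOutput.aemeasurable, hcomp]
    exact h
  have hMI : gaussianMI μ = klDiv J P := by
    change klDiv J (J.fst.prod J.snd) = klDiv J P
    rw [hP, hJ, fst_map_inputOutput, snd_map_inputOutput]
  rw [hMI, klDiv, if_pos ⟨hac, hint⟩, integral_congr_ae hrn, hJ,
    integral_map measurable_inputOutput.aemeasurable hlog.aestronglyMeasurable, ← hcomp]
  rfl

/-- Mixture of the standard Gaussian and Cauchy densities. -/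
noncomputable def comparisonDensity (E y : ℝ) : ℝ :=
  (1 - E) * gaussianPDFReal 0 1 y + E * (Real.pi⁻¹ * (1 + y ^ 2)⁻¹)

lemma measurable_comparisonDensity (E : ℝ) : Measurable (comparisonDensity E) := by
  have := measurable_gaussianPDFReal 0 1
  unfold comparisonDensity
  fun_prop

lemma comparisonDensity_pos {E : ℝ} (h0 : 0 < E) (h1 : E < 1) (y : ℝ) :
    0 < comparisonDensity E y := by
  have := gaussianPDFReal_pos 0 1 y one_ne_zero
  have : 0 < 1 - E := by linarith
  unfold comparisonDensity
  positivity

lemma lintegral_comparisonDensity {E : ℝ} (h0 : 0 < E) (h1 : E < 1) :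
    ∫⁻ y, ENNReal.ofReal (comparisonDensity E y) = 1 := by
  have hi1 : Integrable (fun y => (1 - E) * gaussianPDFReal 0 1 y) :=
    (integrable_gaussianPDFReal 0 1).const_mul _
  have hi2 : Integrable (fun y : ℝ => E * (Real.pi⁻¹ * (1 + y ^ 2)⁻¹)) :=
    (integrable_inv_one_add_sq.const_mul _).const_mul _
  rw [← ofReal_integral_eq_lintegral_ofReal]
  · simp only [comparisonDensity]
    rw [integral_add hi1 hi2, integral_const_mul, integral_const_mul, integral_const_mul,
      integral_gaussianPDFReal_eq_one 0 one_ne_zero, integral_univ_inv_one_add_sq,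
      inv_mul_cancel₀ Real.pi_ne_zero]
    simp
  · exact hi1.add hi2
  · exact ae_of_all _ fun y => (comparisonDensity_pos h0 h1 y).le

lemma lintegral_output (μ : Measure ℝ) [IsProbabilityMeasure μ] {f : ℝ → ENNReal}
    (hf : Measurable f) :
    ∫⁻ p, f (p.1 + p.2) ∂(μ.prod (gaussianReal 0 1)) = ∫⁻ y, outputDensity μ y * f y := by
  have h := snd_map_inputOutput μ
  calc ∫⁻ p, f (p.1 + p.2) ∂(μ.prod (gaussianReal 0 1))
      = ∫⁻ y, f y ∂((μ.prod (gaussianReal 0 1)).map inputOutput).snd := by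
        rw [Measure.snd, lintegral_map hf measurable_snd,
          lintegral_map (f := fun p : ℝ × ℝ => f p.2) (hf.comp measurable_snd)
            measurable_inputOutput]
        rfl
    _ = _ := by
        rw [h, lintegral_withDensity_eq_lintegral_mul _ (measurable_outputDensity μ) hf]
        rfl

lemma measurable_comparison_ratio (μ : Measure ℝ) [IsProbabilityMeasure μ] (E : ℝ) :
    Measurable fun y => comparisonDensity E y / (outputDensity μ y).toReal :=
  (measurable_comparisonDensity E).div (measurable_outputDensity μ).ennreal_toReal

lemma lintegral_comparison_ratio (μ : Measure ℝ) [IsProbabilityMeasure μ] {E : ℝ}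
    (h0 : 0 < E) (h1 : E < 1) :
    ∫⁻ p, ENNReal.ofReal (comparisonDensity E (p.1 + p.2) /
      (outputDensity μ (p.1 + p.2)).toReal) ∂(μ.prod (gaussianReal 0 1)) = 1 := by
  rw [lintegral_output μ (f := fun y => ENNReal.ofReal (comparisonDensity E y /
    (outputDensity μ y).toReal)) (measurable_comparison_ratio μ E).ennreal_ofReal,
    ← lintegral_comparisonDensity h0 h1]
  refine lintegral_congr fun y => ?_
  rw [ENNReal.ofReal_div_of_pos (outputDensity_toReal_pos μ y),
    ENNReal.ofReal_toReal (outputDensity_ne_top μ y),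
    ENNReal.mul_div_cancel (outputDensity_ne_zero μ _) (outputDensity_ne_top μ _)]

lemma integrable_comparison_ratio (μ : Measure ℝ) [IsProbabilityMeasure μ] {E : ℝ}
    (h0 : 0 < E) (h1 : E < 1) :
    Integrable (fun p : ℝ × ℝ => comparisonDensity E (p.1 + p.2) /
      (outputDensity μ (p.1 + p.2)).toReal) (μ.prod (gaussianReal 0 1)) := by
  refine ⟨((measurable_comparison_ratio μ E).comp
    (measurable_fst.add measurable_snd)).aestronglyMeasurable, ?_⟩
  rw [hasFiniteIntegral_iff_ofReal, lintegral_comparison_ratio μ h0 h1]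
  · exact ENNReal.one_lt_top
  · exact ae_of_all _ fun p => div_nonneg (comparisonDensity_pos h0 h1 _).le ENNReal.toReal_nonneg

lemma integral_comparison_ratio (μ : Measure ℝ) [IsProbabilityMeasure μ] {E : ℝ}
    (h0 : 0 < E) (h1 : E < 1) :
    ∫ p, comparisonDensity E (p.1 + p.2) / (outputDensity μ (p.1 + p.2)).toReal
      ∂(μ.prod (gaussianReal 0 1)) = 1 := by
  rw [integral_eq_lintegral_of_nonneg_ae, lintegral_comparison_ratio μ h0 h1, ENNReal.toReal_one]
  · exact ae_of_all _ fun p => div_nonneg (comparisonDensity_pos h0 h1 _).le ENNReal.toReal_nonneg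
  · exact (integrable_comparison_ratio μ h0 h1).aestronglyMeasurable

/-- Pointwise bound on the log-likelihood ratio between the channel law and the
comparison density. -/
noncomputable def ratioBound (E s : ℝ) (p : ℝ × ℝ) : ℝ :=
  (Set.Iic s).indicator id p.1 * p.2 + (Set.Ioi s).indicator 1 p.1 * (p.2 ^ 2 - 1) +
    (6 * s * p.1 + 2 * E)

lemma one_add_sq_le_exp (y : ℝ) : 1 + y ^ 2 ≤ Real.exp (2 * |y|) := by
  have h := Real.add_one_le_exp |y|
  have h2 : Real.exp (2 * |y|) = Real.exp |y| ^ 2 := by rw [← Real.exp_nat_mul]; norm_num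
  rw [h2]
  have := abs_nonneg y
  nlinarith [sq_abs y]

lemma gaussianPDFReal_le_mul_comparisonDensity {E s x : ℝ} (z : ℝ) (hs : 1 ≤ s)
    (hE : E = Real.exp (-s ^ 2)) (hE2 : E ≤ 1 / 2) (hx : 0 ≤ x) :
    gaussianPDFReal 0 1 z ≤ Real.exp (ratioBound E s (x, z)) * comparisonDensity E (x + z) := by
  have hE0 : 0 < E := hE ▸ Real.exp_pos _
  have hw := gaussianPDFReal_pos 0 1 (x + z) one_ne_zero
  unfold comparisonDensity
  rcases le_or_gt x s with h | h
  · have hB : ratioBound E s (x, z) = x * z + (6 * s * x + 2 * E) := by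
      simp [ratioBound, h]
    rw [hB]
    have h1 : gaussianPDFReal 0 1 z =
        Real.exp (x * z + x ^ 2 / 2) * gaussianPDFReal 0 1 (x + z) := by
      rw [gaussianPDFReal_one, gaussianPDFReal_one, mul_left_comm, ← Real.exp_add]
      ring_nf
    have h2 : Real.exp (x * z + x ^ 2 / 2) ≤
        Real.exp (x * z + (6 * s * x + 2 * E)) * (1 - E) := by
      calc Real.exp (x * z + x ^ 2 / 2)
          ≤ Real.exp (x * z + x ^ 2 / 2) * (Real.exp (2 * E) * (1 - E)) := by
            refine le_mul_of_one_le_right (Real.exp_pos _).le ?_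
            nlinarith [Real.add_one_le_exp (2 * E)]
        _ = Real.exp (x * z + x ^ 2 / 2 + 2 * E) * (1 - E) := by
            rw [Real.exp_add _ (2 * E)]; ring
        _ ≤ _ := by
            have h3 : x ^ 2 / 2 ≤ 6 * s * x := by nlinarith [mul_nonneg hx (sub_nonneg.2 h)]
            refine mul_le_mul_of_nonneg_right (Real.exp_le_exp.2 ?_) (by linarith)
            linarith
    calc gaussianPDFReal 0 1 z
        ≤ Real.exp (x * z + (6 * s * x + 2 * E)) * (1 - E) * gaussianPDFReal 0 1 (x + z) := by
          rw [h1]; gcongr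
      _ ≤ _ := by
          rw [mul_add, mul_assoc]
          exact le_add_of_nonneg_right (by positivity)
  · have hB : ratioBound E s (x, z) = z ^ 2 - 1 + (6 * s * x + 2 * E) := by
      simp [ratioBound, h]
    rw [hB]
    have hc : (√(2 * Real.pi))⁻¹ ≤ Real.exp 1 * Real.pi⁻¹ := by
      have h3 := Real.pi_lt_four
      have h4 := Real.pi_pos
      have h5 : Real.pi / Real.exp 1 ≤ √(2 * Real.pi) := by
        apply Real.le_sqrt_of_sq_le
        rw [div_pow, div_le_iff₀ (by positivity)]
        have := Real.add_one_le_exp (1 : ℝ)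
        have h6 : 2 ≤ Real.exp 1 ^ 2 := by nlinarith
        nlinarith [mul_le_mul_of_nonneg_left h6 h4.le]
      calc (√(2 * Real.pi))⁻¹ ≤ (Real.pi / Real.exp 1)⁻¹ := by gcongr
        _ = _ := by rw [inv_div]; rfl
    have h2 : Real.exp 1 * (1 + (x + z) ^ 2) ≤
        Real.exp (z ^ 2 - 1 + (6 * s * x + 2 * E)) * E := by
      calc Real.exp 1 * (1 + (x + z) ^ 2) ≤ Real.exp 1 * Real.exp (2 * |x + z|) := by
            gcongr; exact one_add_sq_le_exp _
        _ = Real.exp (1 + 2 * |x + z|) := by rw [Real.exp_add]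
        _ ≤ Real.exp (z ^ 2 - 1 + (6 * s * x + 2 * E) + -s ^ 2) := by
            refine Real.exp_le_exp.2 ?_
            have h3 := abs_add_le x z
            rw [abs_of_nonneg hx] at h3
            have h4 : 2 * |z| ≤ 1 + z ^ 2 := by nlinarith [sq_abs z, sq_nonneg (|z| - 1)]
            nlinarith [mul_nonneg (sub_nonneg.2 hs) hx, 
              mul_nonneg (zero_le_one.trans hs) (sub_nonneg.2 h.le)]
        _ = _ := by rw [Real.exp_add _ (-s ^ 2), ← hE]
    have hy : 0 < 1 + (x + z) ^ 2 := by positivity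
    calc gaussianPDFReal 0 1 z ≤ Real.exp 1 * Real.pi⁻¹ :=
          (gaussianPDFReal_one_le 0 z).trans hc
      _ = Real.exp 1 * (1 + (x + z) ^ 2) * (Real.pi⁻¹ * (1 + (x + z) ^ 2)⁻¹) := by
          field_simp
      _ ≤ Real.exp (z ^ 2 - 1 + (6 * s * x + 2 * E)) * E *
            (Real.pi⁻¹ * (1 + (x + z) ^ 2)⁻¹) := by
          have := Real.pi_pos
          gcongr
      _ ≤ _ := by
          rw [mul_add, ← mul_assoc _ E]
          refine le_add_of_nonneg_left (mul_nonneg (Real.exp_pos _).le 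
            (mul_nonneg ?_ hw.le))
          linarith

lemma informationDensity_le (μ : Measure ℝ) [IsProbabilityMeasure μ] {E s : ℝ} (hs : 1 ≤ s)
    (hE : E = Real.exp (-s ^ 2)) (hE2 : E ≤ 1 / 2) {p : ℝ × ℝ} (hx : 0 ≤ p.1) :
    informationDensity μ p ≤ ratioBound E s p +
      (comparisonDensity E (p.1 + p.2) / (outputDensity μ (p.1 + p.2)).toReal - 1) := by
  have hE0 : 0 < E := hE ▸ Real.exp_pos _
  have hw := gaussianPDFReal_pos 0 1 p.2 one_ne_zero
  have hq := outputDensity_toReal_pos μ (p.1 + p.2)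
  have hQ := comparisonDensity_pos hE0 (by linarith) (p.1 + p.2)
  have h1 : Real.log (gaussianPDFReal 0 1 p.2) ≤
      ratioBound E s p + Real.log (comparisonDensity E (p.1 + p.2)) := by
    rw [← Real.log_exp (ratioBound E s p), ← Real.log_mul (Real.exp_ne_zero _) hQ.ne']
    exact Real.log_le_log hw (gaussianPDFReal_le_mul_comparisonDensity p.2 hs hE hE2 hx)
  have h2 := Real.log_le_sub_one_of_pos (div_pos hQ hq)
  rw [Real.log_div hQ.ne' hq.ne'] at h2
  rw [informationDensity, Real.log_div hw.ne' hq.ne']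
  linarith

lemma le_informationDensity (μ : Measure ℝ) [IsProbabilityMeasure μ] (p : ℝ × ℝ) :
    -p.2 ^ 2 / 2 ≤ informationDensity μ p := by
  have hq := outputDensity_toReal_pos μ (p.1 + p.2)
  rw [informationDensity, Real.le_log_iff_exp_le
    (div_pos (gaussianPDFReal_pos 0 1 p.2 one_ne_zero) hq), le_div_iff₀ hq, gaussianPDFReal_one,
    sub_zero, mul_comm]
  gcongr
  exact outputDensity_toReal_le μ _

lemma integrable_sq_gaussianReal : Integrable (fun z : ℝ => z ^ 2) (gaussianReal 0 1) :=
  (memLp_id_gaussianReal (μ := 0) (v := 1) 2).integrable_sq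

lemma integral_sq_gaussianReal : ∫ z : ℝ, z ^ 2 ∂(gaussianReal 0 1) = 1 := by
  have h := variance_id_gaussianReal (μ := 0) (v := 1)
  rw [variance_of_integral_eq_zero aemeasurable_id (by simp)] at h
  simpa using h

lemma integrable_id_gaussianReal : Integrable (fun z : ℝ => z) (gaussianReal 0 1) :=
  (memLp_id_gaussianReal (μ := 0) (v := 1) 1).integrable (by simp)

lemma integrable_ratioBound {μ : Measure ℝ} [IsProbabilityMeasure μ] (E s : ℝ)
    (hX : Integrable (fun x => x) μ) :
    Integrable (ratioBound E s) (μ.prod (gaussianReal 0 1)) := by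
  refine Integrable.add (Integrable.add ?_ ?_) ?_
  · exact (hX.indicator measurableSet_Iic).mul_prod integrable_id_gaussianReal
  · exact Integrable.mul_prod (f := (Set.Ioi s).indicator 1) (g := fun z : ℝ => z ^ 2 - 1)
      ((integrable_const (1 : ℝ)).indicator measurableSet_Ioi)
      (integrable_sq_gaussianReal.sub (integrable_const _))
  · exact ((hX.comp_fst _).const_mul (6 * s)).add (integrable_const _)

lemma integral_ratioBound {μ : Measure ℝ} [IsProbabilityMeasure μ] (E s : ℝ)
    (hX : Integrable (fun x => x) μ) :
    ∫ p, ratioBound E s p ∂(μ.prod (gaussianReal 0 1)) = 6 * s * ∫ x, x ∂μ + 2 * E := by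
  have h1 : Integrable (fun p : ℝ × ℝ => (Set.Iic s).indicator id p.1 * p.2)
      (μ.prod (gaussianReal 0 1)) :=
    (hX.indicator measurableSet_Iic).mul_prod integrable_id_gaussianReal
  have h2 : Integrable (fun p : ℝ × ℝ => (Set.Ioi s).indicator 1 p.1 * (p.2 ^ 2 - 1))
      (μ.prod (gaussianReal 0 1)) :=
    Integrable.mul_prod (f := (Set.Ioi s).indicator 1) (g := fun z : ℝ => z ^ 2 - 1)
      ((integrable_const (1 : ℝ)).indicator measurableSet_Ioi)
      (integrable_sq_gaussianReal.sub (integrable_const _))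
  have h3 : Integrable (fun p : ℝ × ℝ => 6 * s * p.1) (μ.prod (gaussianReal 0 1)) :=
    (hX.comp_fst _).const_mul (6 * s)
  have e1 : ∫ p : ℝ × ℝ, (Set.Iic s).indicator id p.1 * p.2 ∂(μ.prod (gaussianReal 0 1)) = 0 := by
    rw [integral_prod_mul ((Set.Iic s).indicator id) (fun z : ℝ => z)]
    simp
  have e2 : ∫ p : ℝ × ℝ, (Set.Ioi s).indicator 1 p.1 * (p.2 ^ 2 - 1)
      ∂(μ.prod (gaussianReal 0 1)) = 0 := by
    rw [integral_prod_mul ((Set.Ioi s).indicator 1) (fun z : ℝ => z ^ 2 - 1),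
      integral_sub integrable_sq_gaussianReal (integrable_const _), integral_sq_gaussianReal]
    simp
  have e3 : ∫ p : ℝ × ℝ, p.1 ∂(μ.prod (gaussianReal 0 1)) = ∫ x, x ∂μ := by
    simpa using integral_fun_fst (μ := μ) (ν := gaussianReal 0 1) (fun x : ℝ => x)
  have h4 : Integrable (fun _ : ℝ × ℝ => 2 * E) (μ.prod (gaussianReal 0 1)) :=
    integrable_const _
  have e12 := integral_add h1 h2
  have e34 := integral_add h3 h4
  have e := integral_add (h1.add h2) (h3.add h4)
  simp only [Pi.add_apply] at e
  simp only [ratioBound]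
  rw [e, e12, e34, e1, e2, integral_const_mul, e3]
  simp

lemma integrable_of_lintegral_ofReal_le {μ : Measure ℝ} {E : ℝ} (h0 : μ (Set.Iio 0) = 0)
    (hm : ∫⁻ x, ENNReal.ofReal x ∂μ ≤ ENNReal.ofReal E) (hE : 0 ≤ E) :
    Integrable (fun x => x) μ ∧ ∫ x, x ∂μ ≤ E := by
  have hae : 0 ≤ᵐ[μ] fun x : ℝ => x := by
    rw [Filter.EventuallyLE, ae_iff]; convert h0 using 2; ext x; simp
  refine ⟨⟨measurable_id.aestronglyMeasurable, ?_⟩, ?_⟩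
  · rw [hasFiniteIntegral_iff_ofReal hae]
    exact hm.trans_lt ENNReal.ofReal_lt_top
  · rw [integral_eq_lintegral_of_nonneg_ae hae measurable_id.aestronglyMeasurable]
    exact ENNReal.toReal_le_of_le_ofReal hE hm

lemma integrable_informationDensity_and_integral_le {μ : Measure ℝ} [IsProbabilityMeasure μ]
    {E s : ℝ} (hs : 1 ≤ s) (hE : E = Real.exp (-s ^ 2)) (hE2 : E ≤ 1 / 2)
    (h0 : μ (Set.Iio 0) = 0) (hm : ∫⁻ x, ENNReal.ofReal x ∂μ ≤ ENNReal.ofReal E) :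
    Integrable (informationDensity μ) (μ.prod (gaussianReal 0 1)) ∧
      ∫ p, informationDensity μ p ∂(μ.prod (gaussianReal 0 1)) ≤ 8 * (E * s) := by
  have hE0 : 0 < E := hE ▸ Real.exp_pos _
  have hE1 : E < 1 := by linarith
  obtain ⟨hX, hXE⟩ := integrable_of_lintegral_ofReal_le h0 hm hE0.le
  have hae : ∀ᵐ x ∂μ, 0 ≤ x := by
    rw [ae_iff]; convert h0 using 2; ext x; simp
  have hae' : ∀ᵐ p ∂(μ.prod (gaussianReal 0 1)), 0 ≤ p.1 :=
    Measure.quasiMeasurePreserving_fst.ae hae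
  have hr := integrable_comparison_ratio μ hE0 hE1
  have hub := (integrable_ratioBound E s hX).add (hr.sub (integrable_const 1))
  have hle : informationDensity μ ≤ᵐ[μ.prod (gaussianReal 0 1)] fun p => ratioBound E s p +
      (comparisonDensity E (p.1 + p.2) / (outputDensity μ (p.1 + p.2)).toReal - 1) := by
    filter_upwards [hae'] with p hp
    exact informationDensity_le μ hs hE hE2 hp
  have hlb : Integrable (fun p : ℝ × ℝ => -p.2 ^ 2 / 2) (μ.prod (gaussianReal 0 1)) :=
    ((integrable_sq_gaussianReal.comp_snd μ).neg).div_const 2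
  have hint : Integrable (informationDensity μ) (μ.prod (gaussianReal 0 1)) :=
    integrable_of_le_of_le (measurable_informationDensity μ).aestronglyMeasurable
      (ae_of_all _ (le_informationDensity μ)) hle hlb hub
  refine ⟨hint, (integral_mono_ae hint hub hle).trans ?_⟩
  have := integral_add (integrable_ratioBound E s hX) (hr.sub (integrable_const 1))
  simp only [Pi.add_apply, Pi.sub_apply] at this ⊢
  rw [this, integral_sub hr (integrable_const 1), integral_ratioBound E s hX,
    integral_comparison_ratio μ hE0 hE1]
  simp only [integral_const, probReal_univ, smul_eq_mul]
  nlinarith [mul_le_mul_of_nonneg_left hXE (by linarith : 0 ≤ 6 * s)]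

lemma C_G_le {E s : ℝ} (hs : 1 ≤ s) (hE : E = Real.exp (-s ^ 2)) (hE2 : E ≤ 1 / 2) :
    C_G E ≤ ((8 * (E * s) : ℝ) : EReal) := by
  refine iSup_le fun μ => iSup_le fun hμ => iSup_le fun h0 => iSup_le fun hm => ?_
  obtain ⟨h1, h2⟩ := integrable_informationDensity_and_integral_le hs hE hE2 h0 hm
  rw [gaussianMI_eq_integral μ h1]
  exact EReal.coe_le_coe_iff.2 h2

/-- On-off keying: the input is `A` with probability `p` and `0` otherwise. -/
noncomputable def onOff (p A : ℝ) : Measure ℝ :=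
  ENNReal.ofReal (1 - p) • Measure.dirac 0 + ENNReal.ofReal p • Measure.dirac A

lemma isProbabilityMeasure_onOff {p : ℝ} (A : ℝ) (h0 : 0 ≤ p) (h1 : p ≤ 1) :
    IsProbabilityMeasure (onOff p A) := by
  constructor
  simp only [onOff, Measure.add_apply, Measure.smul_apply, measure_univ, smul_eq_mul, mul_one]
  rw [← ENNReal.ofReal_add (by linarith) h0]
  simp

lemma onOff_Iio (p : ℝ) {A : ℝ} (hA : 0 ≤ A) : onOff p A (Set.Iio 0) = 0 := by
  simp [onOff, hA]

lemma lintegral_onOff {p : ℝ} (h0 : 0 ≤ p) (A : ℝ) :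
    ∫⁻ x, ENNReal.ofReal x ∂(onOff p A) = ENNReal.ofReal (p * A) := by
  simp [onOff, lintegral_add_measure, lintegral_smul_measure, ENNReal.ofReal_mul h0]

lemma outputDensity_onOff {p : ℝ} (A y : ℝ) (h0 : 0 ≤ p) (h1 : p ≤ 1) :
    (outputDensity (onOff p A) y).toReal =
      (1 - p) * gaussianPDFReal 0 1 y + p * gaussianPDFReal A 1 y := by
  have h := gaussianPDFReal_nonneg 0 1 y
  have hA := gaussianPDFReal_nonneg A 1 y
  have hp : 0 ≤ 1 - p := by linarith
  rw [outputDensity, onOff, lintegral_add_measure, lintegral_smul_measure, lintegral_smul_measure,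
    lintegral_dirac, lintegral_dirac, gaussianPDF, gaussianPDF, smul_eq_mul, smul_eq_mul,
    ← ENNReal.ofReal_mul hp, ← ENNReal.ofReal_mul h0,
    ← ENNReal.ofReal_add (by positivity) (by positivity), ENNReal.toReal_ofReal (by positivity)]

lemma le_informationDensity_onOff_zero {p : ℝ} (A z : ℝ) (h0 : 0 ≤ p) (h1 : p ≤ 1) :
    p - p * (Real.exp (-A ^ 2 / 2) * Real.exp (A * z)) ≤
      informationDensity (onOff p A) (0, z) := by
  have := isProbabilityMeasure_onOff A h0 h1
  have hq := outputDensity_toReal_pos (onOff p A) z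
  have hw := gaussianPDFReal_pos 0 1 z one_ne_zero
  have hA : gaussianPDFReal A 1 z =
      gaussianPDFReal 0 1 z * (Real.exp (-A ^ 2 / 2) * Real.exp (A * z)) := by
    rw [gaussianPDFReal_one, gaussianPDFReal_one, mul_assoc, ← Real.exp_add, ← Real.exp_add]
    ring_nf
  have h := Real.one_sub_inv_le_log_of_pos (div_pos hw hq)
  have e : ((gaussianPDFReal 0 1 z) / (outputDensity (onOff p A) z).toReal)⁻¹ =
      1 - p + p * (Real.exp (-A ^ 2 / 2) * Real.exp (A * z)) := by
    rw [inv_div, div_eq_iff hw.ne', outputDensity_onOff A z h0 h1, hA]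
    ring
  rw [e] at h
  simp only [informationDensity, zero_add]
  linarith

lemma le_informationDensity_onOff {p A : ℝ} (z : ℝ) (h0 : 0 ≤ p)
    (hp : p ≤ Real.exp (-A ^ 2 / 2)) (hA : 0 ≤ A) :
    A ^ 2 / 2 - Real.log 2 - A / 2 - A / 2 * z ^ 2 ≤ informationDensity (onOff p A) (A, z) := by
  have h1 : p ≤ 1 := hp.trans (Real.exp_le_one_iff.2 (by nlinarith [sq_nonneg A]))
  have := isProbabilityMeasure_onOff A h0 h1
  have hq := outputDensity_toReal_pos (onOff p A) (A + z)
  have hw := gaussianPDFReal_pos 0 1 z one_ne_zero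
  set B := A / 2 + A / 2 * z ^ 2 with hB
  have hB0 : 0 ≤ B := by positivity
  have hzB : -(A * z) ≤ B := by
    have : B + A * z = A / 2 * (z + 1) ^ 2 := by rw [hB]; ring
    have : 0 ≤ A / 2 * (z + 1) ^ 2 := by positivity
    linarith
  have hle : (outputDensity (onOff p A) (A + z)).toReal ≤
      gaussianPDFReal 0 1 z * (2 * Real.exp (B - A ^ 2 / 2)) := by
    have e : gaussianPDFReal 0 1 (A + z) =
        gaussianPDFReal 0 1 z * Real.exp (-(A * z) - A ^ 2 / 2) := by
      rw [gaussianPDFReal_one, gaussianPDFReal_one, mul_assoc, ← Real.exp_add]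
      ring_nf
    have i1 : Real.exp (-(A * z) - A ^ 2 / 2) ≤ Real.exp (B - A ^ 2 / 2) :=
      Real.exp_le_exp.2 (by linarith)
    have i2 : p ≤ Real.exp (B - A ^ 2 / 2) :=
      hp.trans (Real.exp_le_exp.2 (by linarith))
    have i3 : (1 - p) * Real.exp (-(A * z) - A ^ 2 / 2) ≤ Real.exp (B - A ^ 2 / 2) :=
      (mul_le_of_le_one_left (Real.exp_pos _).le (by linarith)).trans i1
    rw [outputDensity_onOff A _ h0 h1, gaussianPDFReal_one_add, e]
    calc _ = gaussianPDFReal 0 1 z * ((1 - p) * Real.exp (-(A * z) - A ^ 2 / 2) + p) := by ring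
      _ ≤ _ := by gcongr; linarith
  have h2 := Real.log_le_log hq hle
  rw [Real.log_mul hw.ne' (by positivity), Real.log_mul two_ne_zero (Real.exp_ne_zero _),
    Real.log_exp] at h2
  simp only [informationDensity]
  rw [Real.log_div hw.ne' hq.ne']
  linarith

lemma integral_exp_mul_gaussianReal_standard (t : ℝ) :
    ∫ z, Real.exp (t * z) ∂(gaussianReal 0 1) = Real.exp (t ^ 2 / 2) := by
  have h := mgf_gaussianReal (p := gaussianReal 0 1) (X := id) (by rw [Measure.map_id]) t
  simpa [mgf] using h

lemma integral_informationDensity_onOff_zero_nonneg {p : ℝ} (A : ℝ) (h0 : 0 ≤ p) (h1 : p ≤ 1)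
    (hint : Integrable (fun z => informationDensity (onOff p A) (0, z)) (gaussianReal 0 1)) :
    0 ≤ ∫ z, informationDensity (onOff p A) (0, z) ∂(gaussianReal 0 1) := by
  have hi : Integrable (fun z => p * (Real.exp (-A ^ 2 / 2) * Real.exp (A * z)))
      (gaussianReal 0 1) := ((integrable_exp_mul_gaussianReal A).const_mul _).const_mul _
  have h := integral_mono ((integrable_const p).sub hi) hint
    fun z => le_informationDensity_onOff_zero A z h0 h1
  refine le_trans (le_of_eq ?_) h
  simp only [Pi.sub_apply]
  rw [integral_sub (integrable_const p) hi, integral_const_mul, integral_const_mul,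
    integral_exp_mul_gaussianReal_standard, ← Real.exp_add]
  simp [neg_div]

lemma le_integral_informationDensity_onOff {p A : ℝ} (h0 : 0 ≤ p)
    (hp : p ≤ Real.exp (-A ^ 2 / 2)) (hA : 0 ≤ A)
    (hint : Integrable (fun z => informationDensity (onOff p A) (A, z)) (gaussianReal 0 1)) :
    A ^ 2 / 2 - A - Real.log 2 ≤
      ∫ z, informationDensity (onOff p A) (A, z) ∂(gaussianReal 0 1) := by
  have hi : Integrable (fun z => A / 2 * z ^ 2) (gaussianReal 0 1) :=
    integrable_sq_gaussianReal.const_mul _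
  have h := integral_mono ((integrable_const (A ^ 2 / 2 - Real.log 2 - A / 2)).sub hi) hint
    fun z => le_informationDensity_onOff z h0 hp hA
  refine le_trans (le_of_eq ?_) h
  simp only [Pi.sub_apply]
  rw [integral_sub (integrable_const _) hi, integral_const_mul, integral_sq_gaussianReal]
  simp
  ring

lemma le_integral_informationDensity {p A : ℝ} (h0 : 0 < p)
    (hp : p ≤ Real.exp (-A ^ 2 / 2)) (h1 : p < 1) (hA : 0 ≤ A)
    (hint : Integrable (informationDensity (onOff p A)) ((onOff p A).prod (gaussianReal 0 1))) :
    p * (A ^ 2 / 2 - A - Real.log 2) ≤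
      ∫ q, informationDensity (onOff p A) q ∂((onOff p A).prod (gaussianReal 0 1)) := by
  have := isProbabilityMeasure_onOff A h0.le h1.le
  have hae := hint.prod_right_ae
  have hpos : ENNReal.ofReal p ≠ 0 := by simpa using h0
  have hpos' : ENNReal.ofReal (1 - p) ≠ 0 := by simpa using h1
  have hi := hint.integral_prod_left
  rw [integral_prod _ hint]
  have hsplit : onOff p A =
      ENNReal.ofReal (1 - p) • Measure.dirac 0 + ENNReal.ofReal p • Measure.dirac A := rfl
  have hae' : (Integrable (fun z => informationDensity (onOff p A) (0, z)) (gaussianReal 0 1)) ∧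
      Integrable (fun z => informationDensity (onOff p A) (A, z)) (gaussianReal 0 1) := by
    generalize informationDensity (onOff p A) = F at hae ⊢
    rw [hsplit, ae_add_measure_iff, Measure.ae_ennreal_smul_measure_iff hpos',
      Measure.ae_ennreal_smul_measure_iff hpos, ae_dirac_eq, ae_dirac_eq] at hae
    exact hae
  have e : ∫ x, ∫ z, informationDensity (onOff p A) (x, z) ∂(gaussianReal 0 1) ∂(onOff p A) =
      (1 - p) * ∫ z, informationDensity (onOff p A) (0, z) ∂(gaussianReal 0 1) +
        p * ∫ z, informationDensity (onOff p A) (A, z) ∂(gaussianReal 0 1) := by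
    generalize informationDensity (onOff p A) = F at hi ⊢
    rw [hsplit] at hi ⊢
    rw [integral_add_measure hi.left_of_add_measure hi.right_of_add_measure,
      integral_smul_measure, integral_smul_measure, integral_dirac, integral_dirac,
      ENNReal.toReal_ofReal (by linarith), ENNReal.toReal_ofReal h0.le, smul_eq_mul, smul_eq_mul]
  rw [e]
  have i1 := integral_informationDensity_onOff_zero_nonneg A h0.le h1.le hae'.1
  have i2 := le_integral_informationDensity_onOff h0.le hp hA hae'.2
  have i3 := mul_nonneg (sub_nonneg.2 h1.le) i1
  have i4 := mul_le_mul_of_nonneg_left i2 h0.le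
  linarith

lemma le_C_G {E s : ℝ} (hs : 1 ≤ s) (hE : E = Real.exp (-s ^ 2)) (hE2 : E ≤ 1 / 2) :
    ((E * (√2 * s / 2 - 1 - Real.log 2 / (√2 * s)) : ℝ) : EReal) ≤ C_G E := by
  have hE0 : 0 < E := hE ▸ Real.exp_pos _
  set A := √2 * s with hAdef
  have h2 : 1 ≤ √2 := Real.one_le_sqrt.2 one_le_two
  have hA1 : 1 ≤ A := by nlinarith
  have hA0 : 0 < A := by linarith
  have hAs : -A ^ 2 / 2 = -s ^ 2 := by
    rw [hAdef, mul_pow, Real.sq_sqrt zero_le_two]; ring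
  have hp0 : 0 < E / A := div_pos hE0 hA0
  have hpE : E / A ≤ E := div_le_self hE0.le hA1
  have hp : E / A ≤ Real.exp (-A ^ 2 / 2) := by rw [hAs, ← hE]; exact hpE
  have hp1 : E / A < 1 := by linarith
  have hP := isProbabilityMeasure_onOff A hp0.le hp1.le
  have hz := onOff_Iio (E / A) hA0.le
  have hm : ∫⁻ x, ENNReal.ofReal x ∂(onOff (E / A) A) ≤ ENNReal.ofReal E := by
    rw [lintegral_onOff hp0.le, div_mul_cancel₀ _ hA0.ne']
  obtain ⟨hint, -⟩ := integrable_informationDensity_and_integral_le hs hE hE2 hz hm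
  have h := le_integral_informationDensity hp0 hp hp1 hA0.le hint
  have e : E * (A / 2 - 1 - Real.log 2 / A) = E / A * (A ^ 2 / 2 - A - Real.log 2) := by
    field_simp
  rw [e]
  calc _ ≤ gaussianMI (onOff (E / A) A) := by
        rw [gaussianMI_eq_integral _ hint]; exact EReal.coe_le_coe_iff.2 h
    _ ≤ C_G E := le_iSup_of_le _ (le_iSup_of_le hP (le_iSup_of_le hz (le_iSup_of_le hm le_rfl)))

lemma C_G_toReal_div_bounds {E : ℝ} (h0 : 0 < E) (h1 : E < Real.exp (-1)) :
    1 / √2 - (√(Real.log (1 / E)))⁻¹ - Real.log 2 / √2 * (√(Real.log (1 / E)))⁻¹ ^ 2 ≤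
        (C_G E).toReal / (E * √(Real.log (1 / E))) ∧
      (C_G E).toReal / (E * √(Real.log (1 / E))) ≤ 8 := by
  have hL : Real.log (1 / E) = -Real.log E := by rw [one_div, Real.log_inv]
  have hL1 : 1 ≤ Real.log (1 / E) := by
    have := Real.log_lt_log h0 h1
    rw [Real.log_exp] at this
    linarith
  set s := √(Real.log (1 / E)) with hs
  have hs1 : 1 ≤ s := Real.one_le_sqrt.2 hL1
  have hs0 : 0 < s := by linarith
  have hE : E = Real.exp (-s ^ 2) := by
    rw [hs, Real.sq_sqrt (by linarith), hL, neg_neg, Real.exp_log h0]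
  have hE2 : E ≤ 1 / 2 := by
    have h3 : Real.exp (-1) ≤ 1 / 2 := by
      rw [Real.exp_neg, one_div]
      exact inv_anti₀ two_pos (by linarith [Real.add_one_le_exp (1 : ℝ)])
    linarith
  have hl := le_C_G hs1 hE hE2
  have hu := C_G_le hs1 hE hE2
  have hbot : C_G E ≠ ⊥ := ne_bot_of_le_ne_bot (EReal.coe_ne_bot _) hl
  have htop : C_G E ≠ ⊤ := ne_top_of_le_ne_top (EReal.coe_ne_top _) hu
  rw [← EReal.coe_toReal htop hbot, EReal.coe_le_coe_iff] at hl hu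
  have hEs : 0 < E * s := mul_pos h0 hs0
  refine ⟨?_, (div_le_iff₀ hEs).2 hu⟩
  rw [le_div_iff₀ hEs]
  refine le_trans (le_of_eq ?_) hl
  have h2 : √2 ^ 2 = (2 : ℝ) := Real.sq_sqrt zero_le_two
  have h2' : √2 / 2 = 1 / √2 := by
    rw [div_eq_div_iff two_ne_zero (by positivity)]; linarith
  rw [mul_div_right_comm, h2']
  field_simp

lemma tendsto_inv_sqrt_log :
    Tendsto (fun E : ℝ => (√(Real.log (1 / E)))⁻¹) (nhdsWithin 0 (Set.Ioi 0)) (nhds 0) := by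
  simp only [one_div]
  exact tendsto_inv_atTop_zero.comp (Real.tendsto_sqrt_atTop.comp
    (Real.tendsto_log_atTop.comp tendsto_inv_nhdsGT_zero))

theorem gaussian_low_snr_capacity_lower :
    1 / Real.sqrt 2 ≤
      Filter.liminf (fun E : ℝ => (C_G E).toReal / (E * Real.sqrt (Real.log (1 / E))))
        (nhdsWithin 0 (Set.Ioi 0)) := by
  have hev : ∀ᶠ E : ℝ in nhdsWithin 0 (Set.Ioi 0), 0 < E ∧ E < Real.exp (-1) :=
    Ioo_mem_nhdsGT (Real.exp_pos _)
  have ht := tendsto_inv_sqrt_log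
  have hlim : Tendsto (fun E : ℝ => 1 / √2 - (√(Real.log (1 / E)))⁻¹ -
      Real.log 2 / √2 * (√(Real.log (1 / E)))⁻¹ ^ 2) (nhdsWithin 0 (Set.Ioi 0))
      (nhds (1 / √2)) := by
    simpa using (ht.const_sub (1 / √2)).sub ((ht.pow 2).const_mul (Real.log 2 / √2))
  rw [← hlim.liminf_eq]
  refine liminf_le_liminf (hev.mono fun E h => (C_G_toReal_div_bounds h.1 h.2).1)
    hlim.isBoundedUnder_ge ?_
  exact IsBoundedUnder.isCoboundedUnder_ge
    ⟨8, eventually_map.2 (hev.mono fun E h => (C_G_toReal_div_bounds h.1 h.2).2)⟩
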